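/- Let D : ℝ² → ℝ be a twice continuously differentiable function and let 𝐮 : ℝ² → ℝ² be a twice continuously differentiable vector field with compact support. Define the Peregrine elliptic operator ℰ(𝐮) = 𝐮 − (1/2)·D·∇(∇·(D𝐮)) + (1/6)·D²·∇(∇·𝐮). Then the energy identity ∫_{ℝ²} ℰ(𝐮)·𝐮 dx = ∫_{ℝ²} |𝐮|² dx + (1/3)∫_{ℝ²} (∇·(D𝐮))² dx + (1/6)∫_{ℝ²} (𝐮·∇D)² dx holds, where integrals are with respect to Lebesgue measure on ℝ². -/

import Mathlib

open MeasureTheory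

/-- Partial derivative in the `x`-direction of a scalar function on `ℝ²`. -/
noncomputable def pdx (f : ℝ × ℝ → ℝ) (x : ℝ × ℝ) : ℝ := fderiv ℝ f x (1, 0)

/-- Partial derivative in the `y`-direction of a scalar function on `ℝ²`. -/
noncomputable def pdy (f : ℝ × ℝ → ℝ) (x : ℝ × ℝ) : ℝ := fderiv ℝ f x (0, 1)

/-- Divergence `∇·𝐮 = ∂ₓu₁ + ∂_yu₂` of a vector field on `ℝ²`. -/
noncomputable def vdiv (u : ℝ × ℝ → ℝ × ℝ) (x : ℝ × ℝ) : ℝ :=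
  pdx (fun p => (u p).1) x + pdy (fun p => (u p).2) x

/-- Gradient `∇f = (∂ₓf, ∂_yf)` of a scalar function on `ℝ²`. -/
noncomputable def grad (f : ℝ × ℝ → ℝ) (x : ℝ × ℝ) : ℝ × ℝ := (pdx f x, pdy f x)

/-- Euclidean dot product on `ℝ²`. -/
def dot (a b : ℝ × ℝ) : ℝ := a.1 * b.1 + a.2 * b.2

/-- The Peregrine elliptic operator
`ℰ(𝐮) = 𝐮 − (1/2)·D·∇(∇·(D𝐮)) + (1/6)·D²·∇(∇·𝐮)`. -/
noncomputable def Eop (D : ℝ × ℝ → ℝ) (u : ℝ × ℝ → ℝ × ℝ) (x : ℝ × ℝ) : ℝ × ℝ :=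
  u x - ((1/2) * D x) • grad (vdiv (fun p => D p • u p)) x
      + ((1/6) * (D x)^2) • grad (vdiv u) x

theorem contDiff_pdx {f : ℝ × ℝ → ℝ} {m n : WithTop ℕ∞} (hf : ContDiff ℝ n f) (h : m + 1 ≤ n) :
    ContDiff ℝ m (pdx f) :=
  (hf.fderiv_right h).clm_apply contDiff_const

theorem contDiff_pdy {f : ℝ × ℝ → ℝ} {m n : WithTop ℕ∞} (hf : ContDiff ℝ n f) (h : m + 1 ≤ n) :
    ContDiff ℝ m (pdy f) :=
  (hf.fderiv_right h).clm_apply contDiff_const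

theorem contDiff_vdiv {w : ℝ × ℝ → ℝ × ℝ} {m n : WithTop ℕ∞} (hw : ContDiff ℝ n w)
    (h : m + 1 ≤ n) : ContDiff ℝ m (vdiv w) :=
  (contDiff_pdx hw.fst h).add (contDiff_pdy hw.snd h)

theorem pdx_mul {f g : ℝ × ℝ → ℝ} {x : ℝ × ℝ} (hf : DifferentiableAt ℝ f x)
    (hg : DifferentiableAt ℝ g x) :
    pdx (fun p => f p * g p) x = f x * pdx g x + g x * pdx f x := by
  simp [pdx, fderiv_fun_mul hf hg]

theorem pdy_mul {f g : ℝ × ℝ → ℝ} {x : ℝ × ℝ} (hf : DifferentiableAt ℝ f x)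
    (hg : DifferentiableAt ℝ g x) :
    pdy (fun p => f p * g p) x = f x * pdy g x + g x * pdy f x := by
  simp [pdy, fderiv_fun_mul hf hg]

theorem vdiv_smul {f : ℝ × ℝ → ℝ} {w : ℝ × ℝ → ℝ × ℝ} {x : ℝ × ℝ}
    (hf : DifferentiableAt ℝ f x) (hw : DifferentiableAt ℝ w x) :
    vdiv (fun p => f p • w p) x = f x * vdiv w x + dot (w x) (grad f x) := by
  simp only [vdiv, dot, grad, Prod.smul_fst, Prod.smul_snd, smul_eq_mul, pdx_mul hf hw.fst,
    pdy_mul hf hw.snd]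
  ring

theorem integral_fderiv_eq_zero {f : ℝ × ℝ → ℝ} (hc : HasCompactSupport f)
    (hf : ContDiff ℝ 1 f) (v : ℝ × ℝ) : ∫ x, fderiv ℝ f x v = 0 := by
  have hcont : Continuous fun x => fderiv ℝ f x v :=
    (hf.continuous_fderiv one_ne_zero).clm_apply continuous_const
  have h := integral_mul_fderiv_eq_neg_fderiv_mul_of_integrable
    (μ := (volume : Measure (ℝ × ℝ))) (f := fun _ => (1 : ℝ)) (g := f) (v := v)
    (by simp)
    (by simpa using hcont.integrable_of_hasCompactSupport (hc.fderiv_apply ℝ v))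
    (by simpa using hf.continuous.integrable_of_hasCompactSupport hc)
    (by fun_prop) (fun x _ => hf.differentiable one_ne_zero x)
  simpa using h

theorem hasCompactSupport_vdiv {w : ℝ × ℝ → ℝ × ℝ} (hc : HasCompactSupport w) :
    HasCompactSupport (vdiv w) :=
  ((hc.comp_left (g := Prod.fst) rfl).fderiv_apply ℝ _).add
    ((hc.comp_left (g := Prod.snd) rfl).fderiv_apply ℝ _)

theorem integrable_vdiv {w : ℝ × ℝ → ℝ × ℝ} (hc : HasCompactSupport w)
    (hw : ContDiff ℝ 1 w) : Integrable (vdiv w) :=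
  (contDiff_vdiv (m := 0) hw (by simp)).continuous.integrable_of_hasCompactSupport
    (hasCompactSupport_vdiv hc)

/-- The divergence theorem for a compactly supported vector field. -/
theorem integral_vdiv_eq_zero {w : ℝ × ℝ → ℝ × ℝ} (hc : HasCompactSupport w)
    (hw : ContDiff ℝ 1 w) : ∫ x, vdiv w x = 0 := by
  have h1 : HasCompactSupport fun p => (w p).1 := hc.comp_left (g := Prod.fst) rfl
  have h2 : HasCompactSupport fun p => (w p).2 := hc.comp_left (g := Prod.snd) rfl
  have i1 : Integrable (pdx fun p => (w p).1) :=
    (contDiff_pdx (m := 0) hw.fst (by simp)).continuous.integrable_of_hasCompactSupport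
      (h1.fderiv_apply ℝ _)
  have i2 : Integrable (pdy fun p => (w p).2) :=
    (contDiff_pdy (m := 0) hw.snd (by simp)).continuous.integrable_of_hasCompactSupport
      (h2.fderiv_apply ℝ _)
  unfold vdiv
  rw [integral_add i1 i2]
  simp only [pdx, pdy, integral_fderiv_eq_zero h1 hw.fst, integral_fderiv_eq_zero h2 hw.snd,
    add_zero]

/-- The local form of the energy identity: the two sides differ by an exact divergence. -/
theorem dot_Eop_self {D : ℝ × ℝ → ℝ} (hD : ContDiff ℝ 2 D) {u : ℝ × ℝ → ℝ × ℝ}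
    (hu : ContDiff ℝ 2 u) (x : ℝ × ℝ) :
    dot (Eop D u x) (u x) = dot (u x) (u x) + (1/3) * (vdiv (fun p => D p • u p) x)^2
      + (1/6) * (dot (u x) (grad D x))^2
      + ((1/6) * vdiv (fun p => vdiv u p • D p • D p • u p) x
        - (1/2) * vdiv (fun p => vdiv (fun q => D q • u q) p • D p • u p) x) := by
  have dD : Differentiable ℝ D := hD.differentiable two_ne_zero
  have du : Differentiable ℝ u := hu.differentiable two_ne_zero
  have dDu : Differentiable ℝ fun p => D p • u p := dD.smul du
  have dDDu : Differentiable ℝ fun p => D p • D p • u p := dD.smul dDu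
  have da : Differentiable ℝ (vdiv u) :=
    (contDiff_vdiv hu one_add_one_eq_two.le).differentiable one_ne_zero
  have dW : Differentiable ℝ (vdiv fun p => D p • u p) :=
    (contDiff_vdiv (hD.smul hu) one_add_one_eq_two.le).differentiable one_ne_zero
  rw [vdiv_smul (da x) (dDDu x), vdiv_smul (dD x) (dDu x), vdiv_smul (dW x) (dDu x)]
  have hW := vdiv_smul (dD x) (du x)
  simp only [Eop, dot, grad, Prod.fst_add, Prod.snd_add, Prod.fst_sub, Prod.snd_sub,
    Prod.smul_fst, Prod.smul_snd, smul_eq_mul] at hW ⊢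
  generalize pdx (vdiv fun p => D p • u p) x = Wx
  generalize pdy (vdiv fun p => D p • u p) x = Wy
  rw [hW]
  ring

/-- the energy identity
`∫ ℰ(𝐮)·𝐮 = ∫ |𝐮|² + (1/3)∫ (∇·(D𝐮))² + (1/6)∫ (𝐮·∇D)²`
for `D ∈ C²` and `𝐮 ∈ C²` with compact support. -/
theorem energy_identity
    (D : ℝ × ℝ → ℝ) (hD : ContDiff ℝ 2 D)
    (u : ℝ × ℝ → ℝ × ℝ) (hu : ContDiff ℝ 2 u) (hsupp : HasCompactSupport u) :
    ∫ x, dot (Eop D u x) (u x)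
      = (∫ x, dot (u x) (u x))
        + (1/3) * (∫ x, (vdiv (fun p => D p • u p) x)^2)
        + (1/6) * (∫ x, (dot (u x) (grad D x))^2) := by
  have hDu : ContDiff ℝ 2 fun p => D p • u p := hD.smul hu
  have cDu : HasCompactSupport fun p => D p • u p := hsupp.smul_left (f := D)
  have ha : ContDiff ℝ 1 (vdiv u) := contDiff_vdiv hu one_add_one_eq_two.le
  have hW : ContDiff ℝ 1 (vdiv fun p => D p • u p) := contDiff_vdiv hDu one_add_one_eq_two.le
  have hF : ContDiff ℝ 1 fun p => vdiv u p • D p • D p • u p :=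
    ha.smul ((hD.smul hDu).of_le one_le_two)
  have cF : HasCompactSupport fun p => vdiv u p • D p • D p • u p :=
    (cDu.smul_left (f := D)).smul_left (f := vdiv u)
  have hG : ContDiff ℝ 1 fun p => vdiv (fun q => D q • u q) p • D p • u p :=
    hW.smul (hDu.of_le one_le_two)
  have cG : HasCompactSupport fun p => vdiv (fun q => D q • u q) p • D p • u p :=
    cDu.smul_left (f := vdiv fun q => D q • u q)
  have iu : Integrable fun x => dot (u x) (u x) := by
    refine Continuous.integrable_of_hasCompactSupport ?_ (hsupp.mono fun x hx => ?_)
    · have := hu.continuous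
      unfold dot
      fun_prop
    · contrapose! hx
      simp_all [dot]
  have iW : Integrable fun x => (1/3) * (vdiv (fun p => D p • u p) x)^2 := by
    refine Continuous.integrable_of_hasCompactSupport ?_
      ((hasCompactSupport_vdiv cDu).mono fun x hx => ?_)
    · have := hW.continuous
      fun_prop
    · contrapose! hx
      simp_all
  have ib : Integrable fun x => (1/6) * (dot (u x) (grad D x))^2 := by
    refine Continuous.integrable_of_hasCompactSupport ?_ (hsupp.mono fun x hx => ?_)
    · have := hu.continuous
      have := (contDiff_pdx hD one_add_one_eq_two.le).continuous
      have := (contDiff_pdy hD one_add_one_eq_two.le).continuous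
      unfold dot grad
      fun_prop
    · contrapose! hx
      simp_all [dot]
  have iF := (integrable_vdiv cF hF).const_mul (1/6)
  have iG := (integrable_vdiv cG hG).const_mul (1/2)
  have iuW : Integrable fun x =>
      dot (u x) (u x) + (1/3) * (vdiv (fun p => D p • u p) x)^2 := iu.add iW
  have iuWb : Integrable fun x => dot (u x) (u x) + (1/3) * (vdiv (fun p => D p • u p) x)^2
      + (1/6) * (dot (u x) (grad D x))^2 := iuW.add ib
  have iFG : Integrable fun x => (1/6) * vdiv (fun p => vdiv u p • D p • D p • u p) x
      - (1/2) * vdiv (fun p => vdiv (fun q => D q • u q) p • D p • u p) x := iF.sub iG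
  rw [integral_congr_ae (.of_forall (dot_Eop_self hD hu)), integral_add iuWb iFG,
    integral_sub iF iG, integral_add iuW ib, integral_add iu iW]
  simp only [integral_const_mul, integral_vdiv_eq_zero cF hF, integral_vdiv_eq_zero cG hG,
    mul_zero, sub_zero, add_zero]
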